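/- arXiv:0902.1470 — 2 statements merged into one kernel-verified Lean document; each statement's English description precedes it below -/
import Mathlib

section
/- Let S be a semitransitive subsemigroup of the singular part I_n \ S_n with |S| ≤ 2n. Then for every idempotent e ∈ S and every transitivity block C of S, either the domain of e is disjoint from C, or C is contained in the domain of e. -/
/-- `ISemi n` is the symmetric inverse semigroup `I_n`, realized as the set of all
partial injective maps (partial permutations) of the `n`-element set `Fin n`,
with composition given by `PEquiv.trans` (apply the left factor first, matching
the right-action convention `x φ`). -/
abbrev ISemi (n : ℕ) := PEquiv (Fin n) (Fin n)

/-- `S` is a subsemigroup of `I_n`: a subset closed under composition. -/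
def IsSubsemigroup {n : ℕ} (S : Set (ISemi n)) : Prop :=
  ∀ a ∈ S, ∀ b ∈ S, a.trans b ∈ S

/-- `φ` belongs to the singular part `I_n \ S_n`: its domain is a proper subset
of the underlying set, i.e. it is undefined somewhere. -/
def IsSingular {n : ℕ} (φ : ISemi n) : Prop :=
  ∃ x : Fin n, φ x = none

/-- `S` is semitransitive: for all `x, y` there is `φ ∈ S` with `φ x = y` or `φ y = x`. -/
def Semitransitive {n : ℕ} (S : Set (ISemi n)) : Prop :=
  ∀ x y : Fin n, ∃ φ ∈ S, φ x = some y ∨ φ y = some x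

/-- The semitransitivity preorder induced by `S`: `x ≥ y` iff some `φ ∈ S` maps `x` to `y`. -/
def STGe {n : ℕ} (S : Set (ISemi n)) (x y : Fin n) : Prop :=
  ∃ φ ∈ S, φ x = some y

/-- The transitivity block of `x`: the equivalence class of `x` under `x ≥ y ∧ y ≥ x`. -/
def STBlock {n : ℕ} (S : Set (ISemi n)) (x : Fin n) : Set (Fin n) :=
  {y | STGe S x y ∧ STGe S y x}

/-- `k`-th power of `φ` under composition (`pePow φ 0` is the identity). -/
def pePow {n : ℕ} (φ : ISemi n) : ℕ → ISemi n
  | 0 => PEquiv.refl (Fin n)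
  | k + 1 => (pePow φ k).trans φ

namespace PEquiv

theorem trans_apply_eq_some {α β γ : Type*} {f : α ≃. β} {g : β ≃. γ} {a : α} {b : β} {c : γ}
    (hf : f a = some b) (hg : g b = some c) : (f.trans g) a = some c :=
  (PEquiv.trans_eq_some f g a c).2 ⟨b, hf, hg⟩

theorem trans_apply_eq_none_of_left {α β γ : Type*} {f : α ≃. β} (g : β ≃. γ) {a : α}
    (hf : f a = none) : (f.trans g) a = none := by
  cases h : (f.trans g) a with
  | none => rfl
  | some c =>
    obtain ⟨b, hb, -⟩ := (PEquiv.trans_eq_some f g a c).1 h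
    rw [hf] at hb
    exact (Option.some_ne_none _ hb.symm).elim

theorem eq_of_apply_eq_some {α β : Type*} (f : α ≃. β) {a a' : α} {b : β}
    (h : f a = some b) (h' : f a' = some b) : a = a' :=
  f.inj h h'

/-- An idempotent partial permutation is a partial identity. -/
theorem eq_of_idempotent {α : Type*} {e : α ≃. α} (he : e.trans e = e) {a b : α}
    (h : e a = some b) : a = b := by
  have h2 : (e.trans e) a = some b := by rw [he, h]
  obtain ⟨c, hc, hcb⟩ := (PEquiv.trans_eq_some e e a b).1 h2
  obtain rfl : b = c := Option.some.inj (h.symm.trans hc)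
  exact e.eq_of_apply_eq_some h hcb

theorem apply_self_of_idempotent {α : Type*} {e : α ≃. α} (he : e.trans e = e) {a : α}
    (h : e a ≠ none) : e a = some a := by
  obtain ⟨b, hb⟩ := Option.ne_none_iff_exists'.1 h
  rw [hb, eq_of_idempotent he hb]

theorem trans_idempotent {α : Type*} {e f : α ≃. α} (he : e.trans e = e) (hf : f.trans f = f) :
    (e.trans f).trans (e.trans f) = e.trans f := by
  ext a c
  constructor
  · intro h
    obtain ⟨b, hb, hbc⟩ := (PEquiv.trans_eq_some _ _ a c).1 h
    obtain ⟨b', h1, h2⟩ := (PEquiv.trans_eq_some _ _ a b).1 hb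
    obtain ⟨c', h3, h4⟩ := (PEquiv.trans_eq_some _ _ b c).1 hbc
    obtain rfl := eq_of_idempotent he h1
    obtain rfl := eq_of_idempotent hf h2
    exact hbc
  · intro h
    obtain ⟨b, h1, h2⟩ := (PEquiv.trans_eq_some _ _ a c).1 h
    obtain rfl := eq_of_idempotent he h1
    obtain rfl := eq_of_idempotent hf h2
    exact trans_apply_eq_some h h

instance {α β : Type*} [Finite α] [Finite β] : Finite (α ≃. β) := DFunLike.finite _

end PEquiv

/-- Every element `γ` of a subsemigroup of `I_n` has an idempotent right multiple in it
that fixes all fixed points of `γ`. -/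
theorem exists_idempotent_right_multiple {n : ℕ} {S : Set (ISemi n)} (hsub : IsSubsemigroup S)
    {γ : ISemi n} (hγ : γ ∈ S) :
    ∃ g ∈ S, g.trans g = g ∧ (∀ x, γ x = some x → g x = some x) ∧
      ∃ δ ∈ S, g = γ.trans δ := by
  let _ : Semigroup (ISemi n) := { mul := PEquiv.trans, mul_assoc := PEquiv.trans_assoc }
  let _ : TopologicalSpace (ISemi n) := ⊥
  have : DiscreteTopology (ISemi n) := ⟨rfl⟩
  obtain ⟨g, ⟨hg, hfix, hδ⟩, hgg⟩ := exists_idempotent_in_compact_subsemigroup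
    (M := ISemi n) (fun _ => continuous_of_discreteTopology)
    {g | g ∈ S ∧ (∀ x, γ x = some x → g x = some x) ∧ ∃ δ ∈ S, g = γ.trans δ}
    ⟨γ.trans γ, hsub _ hγ _ hγ, fun x hx => PEquiv.trans_apply_eq_some hx hx, γ, hγ, rfl⟩
    (Set.toFinite _).isCompact (by
      rintro a ⟨ha, hfa, δ, hδ, rfl⟩ b ⟨hb, hfb, -⟩
      exact ⟨hsub _ ha _ hb, fun x hx => PEquiv.trans_apply_eq_some (hfa x hx) (hfb x hx),
        δ.trans b, hsub _ hδ _ hb, PEquiv.trans_assoc _ _ _⟩)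
  exact ⟨g, hg, hgg, hfix, hδ⟩

theorem STGe.refl {n : ℕ} {S : Set (ISemi n)} (hst : Semitransitive S) (x : Fin n) :
    STGe S x x := by
  obtain ⟨φ, hφ, h⟩ := hst x x
  exact ⟨φ, hφ, h.elim id id⟩

theorem STGe.trans {n : ℕ} {S : Set (ISemi n)} (hsub : IsSubsemigroup S) {x y z : Fin n}
    (hxy : STGe S x y) (hyz : STGe S y z) : STGe S x z := by
  obtain ⟨φ, hφ, h⟩ := hxy
  obtain ⟨ψ, hψ, h'⟩ := hyz
  exact ⟨_, hsub _ hφ _ hψ, PEquiv.trans_apply_eq_some h h'⟩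

theorem STGe.total {n : ℕ} {S : Set (ISemi n)} (hst : Semitransitive S) (x y : Fin n) :
    STGe S x y ∨ STGe S y x := by
  obtain ⟨φ, hφ, h | h⟩ := hst x y
  exacts [.inl ⟨φ, hφ, h⟩, .inr ⟨φ, hφ, h⟩]

/-- The idempotent `e ∈ S` splits the transitivity block of `c`. -/
def Splits {n : ℕ} (S : Set (ISemi n)) (c : Fin n) (e : ISemi n) : Prop :=
  e ∈ S ∧ e.trans e = e ∧ (∃ x ∈ STBlock S c, e x ≠ none) ∧ ∃ y ∈ STBlock S c, e y = none

/-- Two idempotents of `S` separating two points of a block and agreeing strictly above it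
force `S` to have more than `2n` elements. -/
theorem two_mul_lt_ncard_of_separating {n : ℕ} {S : Set (ISemi n)} (hsub : IsSubsemigroup S)
    (hst : Semitransitive S) {c : Fin n} (E : Bool → ISemi n) (X : Bool → Fin n)
    (hES : ∀ i, E i ∈ S) (hE : ∀ i, (E i).trans (E i) = E i)
    (hX : ∀ i, X i ∈ STBlock S c)
    (hsome : ∀ i, E i (X i) = some (X i)) (hnone : ∀ i, E i (X !i) = none)
    (habove : ∀ w, ¬ STGe S c w → (∀ i, E i w = some w) ∨ ∀ i, E i w = none) :
    2 * n < S.ncard := by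
  set f := (E true).trans (E false) with hf
  have hfX : ∀ i, f (X i) = none := by
    rintro (_ | _)
    · exact PEquiv.trans_apply_eq_none_of_left _ (hnone true)
    · cases h : f (X true) with
      | none => rfl
      | some a =>
        obtain ⟨b, h1, h2⟩ := (PEquiv.trans_eq_some _ _ _ _).1 h
        obtain rfl := PEquiv.eq_of_idempotent (hE _) h1
        exact absurd (hnone false) (by simp [h2])
  have hff : f.trans f = f := PEquiv.trans_idempotent (hE _) (hE _)
  have key : ∀ v j, ∃ φ ∈ S,
      (φ (X j) = some v ∧ ∀ w, E j w = none → φ w = none) ∨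
      (¬ STGe S c v ∧ φ v = some (X j) ∧ (∀ w u, φ w = some u → E j u ≠ none) ∧
        ((∀ i, φ (X i) = none) ∨ ∀ i, E i v = none)) := by
    intro v j
    by_cases hv : STGe S c v
    · obtain ⟨φ, hφ, h⟩ := STGe.trans hsub (hX j).2 hv
      exact ⟨_, hsub _ (hES j) _ hφ, .inl ⟨PEquiv.trans_apply_eq_some (hsome j) h,
        fun w hw => PEquiv.trans_apply_eq_none_of_left _ hw⟩⟩
    · obtain ⟨φ, hφ, h⟩ := STGe.trans hsub ((STGe.total hst c v).resolve_left hv) (hX j).1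
      have hran : ∀ (ψ : ISemi n) (w u : Fin n), (ψ.trans (E j)) w = some u → E j u ≠ none := by
        intro ψ w u hwu
        obtain ⟨b, -, hb⟩ := (PEquiv.trans_eq_some _ _ _ _).1 hwu
        obtain rfl := PEquiv.eq_of_idempotent (hE j) hb
        simp [hb]
      rcases habove v hv with h1 | h1
      · refine ⟨(f.trans φ).trans (E j), hsub _ (hsub _ (hsub _ (hES _) _ (hES _)) _ hφ) _ (hES j),
          .inr ⟨hv, ?_, hran _, .inl fun i => ?_⟩⟩
        · exact PEquiv.trans_apply_eq_some (PEquiv.trans_apply_eq_some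
            (PEquiv.trans_apply_eq_some (h1 true) (h1 false)) h) (hsome j)
        · exact PEquiv.trans_apply_eq_none_of_left _
            (PEquiv.trans_apply_eq_none_of_left _ (hfX i))
      · exact ⟨φ.trans (E j), hsub _ hφ _ (hES j),
          .inr ⟨hv, PEquiv.trans_apply_eq_some h (hsome j), hran _, .inr h1⟩⟩
  choose F hFS hF using key
  have hEX : ∀ i j, E i (X j) ≠ none → i = j := by
    intro i j h
    by_contra hij
    obtain rfl : j = !i := by cases i <;> cases j <;> simp_all
    exact h (hnone i)
  have mixed : ∀ v i w j, (F v i (X i) = some v ∧ ∀ u, E i u = none → F v i u = none) →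
      (F w j w = some (X j) ∧ ((∀ i, F w j (X i) = none) ∨ ∀ i, E i w = none)) →
      F v i ≠ F w j := by
    rintro v i w j ⟨h1, h2⟩ ⟨h3, h4⟩ h
    rcases h4 with h4 | h4
    · have := h4 i
      rw [← h, h1] at this
      exact Option.some_ne_none _ this
    · have := h2 w (h4 i)
      rw [h, h3] at this
      exact Option.some_ne_none _ this
  have hinj : Function.Injective (fun p : Fin n × Bool => F p.1 p.2) := by
    rintro ⟨v, i⟩ ⟨w, j⟩ h
    change F v i = F w j at h
    rcases hF v i with hv | ⟨-, hv1, hv2, hv3⟩ <;> rcases hF w j with hw | ⟨-, hw1, hw2, hw3⟩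
    · have hji : j = i := by
        refine hEX j i fun h0 => ?_
        have := hw.2 _ h0
        rw [← h, hv.1] at this
        exact Option.some_ne_none _ this
      subst hji
      have := hv.1
      rw [h, hw.1] at this
      rw [Option.some.inj this]
    · exact (mixed v i w j hv ⟨hw1, hw3⟩ h).elim
    · exact (mixed w j v i hw ⟨hv1, hv3⟩ h.symm).elim
    · have hji : j = i := hEX j i (hw2 v _ (h ▸ hv1))
      subst hji
      rw [h] at hv1
      rw [PEquiv.eq_of_apply_eq_some _ hv1 hw1]
  have hfne : ∀ v i, F v i ≠ f := by
    intro v i h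
    rcases hF v i with ⟨h1, -⟩ | ⟨hv, h1, -⟩
    · rw [h, hfX] at h1
      exact Option.some_ne_none _ h1.symm
    · rw [h] at h1
      rw [PEquiv.eq_of_idempotent hff h1] at hv
      exact hv (hX i).1
  have hsubset : Set.range (fun p : Fin n × Bool => F p.1 p.2) ⊂ S := by
    refine ⟨by rintro _ ⟨p, rfl⟩; exact hFS _ _, fun h => ?_⟩
    obtain ⟨p, hp⟩ := h (hsub _ (hES true) _ (hES false))
    exact hfne _ _ hp
  have := Set.ncard_lt_ncard hsubset (Set.toFinite S)
  rw [Set.ncard_range_of_injective hinj] at this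
  simpa [mul_comm] using this

/-- If no block strictly above that of `c` is split but that of `c` is, then there are two
idempotents as in `two_mul_lt_ncard_of_separating`. -/
theorem two_mul_lt_ncard_of_splits {n : ℕ} {S : Set (ISemi n)} (hsub : IsSubsemigroup S)
    (hst : Semitransitive S) {c : Fin n} (hc : ∃ e, Splits S c e)
    (hmax : ∀ w e, STGe S w c → ¬ STGe S c w → ¬ Splits S w e) :
    2 * n < S.ncard := by
  classical
  let D : ISemi n → Finset (Fin n) := fun g => Finset.univ.filter fun w => g w ≠ none
  have hD : ∀ g w, w ∈ D g ↔ g w ≠ none := fun g w => by simp [D]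
  obtain ⟨e, he, hmin⟩ :=
    (Set.toFinite {e | Splits S c e}).exists_minimalFor (fun g => (D g).card) _ hc
  obtain ⟨heS, hee, ⟨x, hx, hex⟩, y, hy, hey⟩ := he
  have hex' := PEquiv.apply_self_of_idempotent hee hex
  have hle : ∀ g ∈ S, g.trans g = g → g x = some x → D g ⊆ D e → D e ⊆ D g := by
    intro g hg hgg hgx hsubs
    have hgy : g y = none := by
      by_contra h
      exact (hD e y).1 (hsubs ((hD g y).2 h)) hey
    have hcard : (D e).card ≤ (D g).card :=
      hmin (show Splits S c g from ⟨hg, hgg, ⟨x, hx, by simp [hgx]⟩, y, hy, hgy⟩)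
        (Finset.card_le_card hsubs)
    exact (Finset.eq_of_subset_of_card_le hsubs hcard).ge
  obtain ⟨α, hα, hαxy⟩ := STGe.trans hsub hx.2 hy.1
  obtain ⟨β, hβ, hβyx⟩ := STGe.trans hsub hy.2 hx.1
  have hdomβ : ∃ g ∈ S, g.trans g = g ∧ g y = some y ∧
      ∀ w, g w ≠ none → ∃ u, β w = some u ∧ e u = some u ∧ STGe S u w := by
    obtain ⟨g, hg, hgg, hfix, δ, hδ, hgδ⟩ :=
      exists_idempotent_right_multiple hsub (hsub _ hβ _ (hsub _ heS _ hα))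
    refine ⟨g, hg, hgg, hfix y (PEquiv.trans_apply_eq_some hβyx
      (PEquiv.trans_apply_eq_some hex' hαxy)), fun w hw => ?_⟩
    have hgw := PEquiv.apply_self_of_idempotent hgg hw
    rw [hgδ] at hgw
    obtain ⟨b, h1, h2⟩ := (PEquiv.trans_eq_some _ _ _ _).1 hgw
    obtain ⟨u, h3, h4⟩ := (PEquiv.trans_eq_some _ _ _ _).1 h1
    obtain ⟨u', h5, h6⟩ := (PEquiv.trans_eq_some _ _ _ _).1 h4
    obtain rfl := PEquiv.eq_of_idempotent hee h5
    exact ⟨u, h3, h5, _, hsub _ hα _ hδ, PEquiv.trans_apply_eq_some h6 h2⟩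
  obtain ⟨g, hg, hgg, hgy, hgβ⟩ := hdomβ
  have hgx : g x = none := by
    by_contra h
    have hgx := PEquiv.apply_self_of_idempotent hgg h
    have h1 : D e ⊆ D (e.trans g) := hle _ (hsub _ heS _ hg) (PEquiv.trans_idempotent hee hgg)
      (PEquiv.trans_apply_eq_some hex' hgx) fun w hw => (hD _ _).2 fun h0 =>
        (hD _ _).1 hw (PEquiv.trans_apply_eq_none_of_left _ h0)
    have h2 : D e ⊆ D g := by
      intro w hw
      have hew := PEquiv.apply_self_of_idempotent hee ((hD _ _).1 hw)
      obtain ⟨b, hb⟩ := Option.ne_none_iff_exists'.1 ((hD _ _).1 (h1 hw))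
      obtain ⟨w', h3, h4⟩ := (PEquiv.trans_eq_some _ _ _ _).1 hb
      obtain rfl := PEquiv.eq_of_idempotent hee h3
      exact (hD _ _).2 (by simp [h4])
    have h3 : (D g).card ≤ (D e).card := by
      refine Finset.card_le_card_of_injOn (fun w => (β w).getD w) ?_ ?_
      · intro w hw
        obtain ⟨u, hu, heu, -⟩ := hgβ w ((hD _ _).1 hw)
        exact (hD _ _).2 (by simp [hu, heu])
      · intro w hw w' hw' hww
        obtain ⟨u, hu, -⟩ := hgβ w ((hD _ _).1 hw)
        obtain ⟨u', hu', -⟩ := hgβ w' ((hD _ _).1 hw')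
        simp only [hu, hu', Option.getD_some] at hww
        subst hww
        exact β.eq_of_apply_eq_some hu hu'
    have h4 := Finset.eq_of_subset_of_card_le h2 h3
    exact (hD e y).1 (h4 ▸ (hD g y).2 (by simp [hgy])) hey
  have heα : ∀ w, e w ≠ none → ∃ u, α w = some u ∧ g u = some u ∧ STGe S u w := by
    obtain ⟨g', hg', hgg', hfix, δ, hδ, hgδ⟩ :=
      exists_idempotent_right_multiple hsub (hsub _ heS _ (hsub _ hα _ (hsub _ hg _ hβ)))
    have hsubs := hle g' hg' hgg' (hfix x (PEquiv.trans_apply_eq_some hex'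
      (PEquiv.trans_apply_eq_some hαxy (PEquiv.trans_apply_eq_some hgy hβyx)))) (by
        intro w hw
        refine (hD _ _).2 fun h0 => (hD _ _).1 hw ?_
        rw [hgδ]
        exact PEquiv.trans_apply_eq_none_of_left _ (PEquiv.trans_apply_eq_none_of_left _ h0))
    intro w hw
    have hgw := PEquiv.apply_self_of_idempotent hgg' ((hD _ _).1 (hsubs ((hD _ _).2 hw)))
    rw [hgδ] at hgw
    obtain ⟨b, h1, h2⟩ := (PEquiv.trans_eq_some _ _ _ _).1 hgw
    obtain ⟨w', h3, h4⟩ := (PEquiv.trans_eq_some _ _ _ _).1 h1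
    obtain rfl := PEquiv.eq_of_idempotent hee h3
    obtain ⟨u, h5, h6⟩ := (PEquiv.trans_eq_some _ _ _ _).1 h4
    obtain ⟨u', h7, h8⟩ := (PEquiv.trans_eq_some _ _ _ _).1 h6
    obtain rfl := PEquiv.eq_of_idempotent hgg h7
    exact ⟨u, h5, h7, _, hsub _ hβ _ hδ, PEquiv.trans_apply_eq_some h8 h2⟩
  have hiff : ∀ w, ¬ STGe S c w → (e w ≠ none ↔ g w ≠ none) := by
    intro w hw
    have hwc := (STGe.total hst c w).resolve_left hw
    have hunsplit : ∀ k ∈ S, k.trans k = k → ∀ u ∈ STBlock S w, k u ≠ none → k w ≠ none :=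
      fun k hk hkk u hu hku hkw =>
        hmax w k hwc hw ⟨hk, hkk, ⟨u, hu, hku⟩, w, ⟨.refl hst w, .refl hst w⟩, hkw⟩
    constructor
    · intro h
      obtain ⟨u, h1, h2, h3⟩ := heα w h
      exact hunsplit g hg hgg u ⟨⟨α, hα, h1⟩, h3⟩ (by simp [h2])
    · intro h
      obtain ⟨u, h1, h2, h3⟩ := hgβ w h
      exact hunsplit e heS hee u ⟨⟨β, hβ, h1⟩, h3⟩ (by simp [h2])
  refine two_mul_lt_ncard_of_separating hsub hst (c := c) (fun i => bif i then e else g)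
    (fun i => bif i then x else y) ?_ ?_ ?_ ?_ ?_ ?_
  · rintro (_ | _) <;> assumption
  · rintro (_ | _) <;> assumption
  · rintro (_ | _) <;> assumption
  · rintro (_ | _) <;> assumption
  · rintro (_ | _) <;> assumption
  · intro w hw
    by_cases h : e w = none
    · have h' : g w = none := not_not.1 fun h' => (hiff w hw).2 h' h
      exact .inr (by rintro (_ | _) <;> assumption)
    · have h1 := PEquiv.apply_self_of_idempotent hee h
      have h2 := PEquiv.apply_self_of_idempotent hgg ((hiff w hw).1 h)
      exact .inl (by rintro (_ | _) <;> assumption)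

/-- for a semitransitive subsemigroup `S` of the singular part with
`|S| ≤ 2n`, the domain of any idempotent of `S` is either disjoint from, or
contains, each transitivity block. -/
theorem stmt5 (n : ℕ) (hn : 1 ≤ n) (S : Set (ISemi n))
    (hsub : IsSubsemigroup S)
    (hsing : ∀ φ ∈ S, IsSingular φ)
    (hst : Semitransitive S)
    (hcard : S.ncard ≤ 2 * n)
    (e : ISemi n) (he : e ∈ S) (hid : e.trans e = e)
    (x : Fin n) :
    (∀ y ∈ STBlock S x, e y = none) ∨ (∀ y ∈ STBlock S x, (e y).isSome) := by
  by_contra hcon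
  push Not at hcon
  obtain ⟨⟨y, hy, hey⟩, z, hz, hez⟩ := hcon
  have hsplit : Splits S x e := ⟨he, hid, ⟨y, hy, hey⟩, z, hz, by simpa using hez⟩
  obtain ⟨c, hc, hmin⟩ := (Set.toFinite {c | ∃ e, Splits S c e}).exists_minimalFor
    (fun c => {w | STGe S w c}.ncard) _ ⟨x, e, hsplit⟩
  refine absurd (two_mul_lt_ncard_of_splits hsub hst hc fun w k hwc hcw hk => ?_) hcard.not_gt
  have hlt : {v | STGe S v w}.ncard < {v | STGe S v c}.ncard :=
    Set.ncard_lt_ncard ⟨fun v hv => STGe.trans hsub hv hwc, fun h => hcw (h (STGe.refl hst c))⟩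
      (Set.toFinite _)
  exact hlt.not_ge (hmin ⟨k, hk⟩ hlt.le)
end

section
/- Let S be a semitransitive subsemigroup of the singular part I_n \ S_n with |S| ≤ 2n, and let e be a non-zero idempotent of S. Then every element φ of eSe = {e·σ·e : σ ∈ S} is either nilpotent (some power of φ is the empty map) or a group element over e (some power of φ equals e). -/
instance finite_iSemi (n : ℕ) : Finite (ISemi n) :=
  DFunLike.finite _

lemma PEquiv.eq_of_apply_eq_some_s6 {α β : Type*} (φ : PEquiv α β) {x y : α} {z : β}
    (hx : φ x = some z) (hy : φ y = some z) : x = y := by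
  rw [← φ.eq_some_iff] at hx hy
  exact Option.some_injective _ (hx.symm.trans hy)

section Idempotent

variable {n : ℕ} {c g : ISemi n}

lemma apply_eq_of_idem (hc : c.trans c = c) {x y : Fin n} (h : c x = some y) : y = x := by
  have h1 := h
  rw [← hc, PEquiv.trans_eq_some] at h1
  obtain ⟨z, hz, hzy⟩ := h1
  obtain rfl : y = z := Option.some_injective _ (h.symm.trans hz)
  exact c.eq_of_apply_eq_some_s6 hzy h

lemma fix_of_idem (hc : c.trans c = c) {x y : Fin n} (h : c x = some y) : c x = some x := by
  rw [h, apply_eq_of_idem hc h]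

lemma symm_eq_of_idem (hc : c.trans c = c) : c.symm = c := by
  ext x y
  rw [PEquiv.eq_some_iff]
  constructor <;> intro h
  · obtain rfl := apply_eq_of_idem hc h
    exact h
  · obtain rfl := apply_eq_of_idem hc h
    exact h

/-- An idempotent is determined by its fixed points. -/
lemma idem_ext (hc : c.trans c = c) (hg : g.trans g = g)
    (h : ∀ x, c x = some x ↔ g x = some x) : c = g := by
  ext x y
  constructor <;> intro hxy
  · obtain rfl := apply_eq_of_idem hc hxy
    exact (h _).1 hxy
  · obtain rfl := apply_eq_of_idem hg hxy
    exact (h _).2 hxy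

lemma trans_idem (hc : c.trans c = c) (hg : g.trans g = g) :
    (c.trans g).trans (c.trans g) = c.trans g := by
  ext x y
  simp only [PEquiv.trans_eq_some]
  constructor
  · rintro ⟨z, ⟨a, ha, haz⟩, b, hb, hby⟩
    obtain rfl := apply_eq_of_idem hc ha
    obtain rfl := apply_eq_of_idem hg haz
    obtain rfl := apply_eq_of_idem hc hb
    exact ⟨_, hb, hby⟩
  · rintro ⟨z, hz, hzy⟩
    obtain rfl := apply_eq_of_idem hc hz
    obtain rfl := apply_eq_of_idem hg hzy
    exact ⟨_, ⟨_, hz, hzy⟩, _, hz, hzy⟩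

end Idempotent

section Power

variable {n : ℕ} (φ : ISemi n)

lemma pePow_one : pePow φ 1 = φ := PEquiv.refl_trans φ

lemma pePow_add (a b : ℕ) : pePow φ (a + b) = (pePow φ a).trans (pePow φ b) := by
  induction b with
  | zero => exact (PEquiv.trans_refl _).symm
  | succ b ih =>
    change (pePow φ (a + b)).trans φ = (pePow φ a).trans ((pePow φ b).trans φ)
    rw [ih, PEquiv.trans_assoc]

lemma exists_pePow_idem :
    ∃ k, 1 ≤ k ∧ (pePow φ k).trans (pePow φ k) = pePow φ k := by
  obtain ⟨a, p, hp, h⟩ : ∃ a p, 1 ≤ p ∧ pePow φ (a + p) = pePow φ a := by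
    obtain ⟨a, b, hab, h⟩ := Finite.exists_ne_map_eq_of_infinite (pePow φ)
    rcases lt_or_gt_of_ne hab with hlt | hlt
    · exact ⟨a, b - a, by omega, by rw [Nat.add_sub_cancel' hlt.le, h]⟩
    · exact ⟨b, a - b, by omega, by rw [Nat.add_sub_cancel' hlt.le, h]⟩
  have hper : ∀ j m, a ≤ m → pePow φ (m + j * p) = pePow φ m := by
    intro j
    induction j with
    | zero => simp
    | succ j ih =>
      intro m hm
      obtain ⟨d, rfl⟩ := Nat.exists_eq_add_of_le hm
      have : a + d + (j + 1) * p = a + p + (d + j * p) := by ring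
      rw [this, pePow_add, h, ← pePow_add, ← add_assoc, ih _ hm]
  refine ⟨(a + 1) * p, by nlinarith, ?_⟩
  rw [← pePow_add, hper _ _ (by nlinarith)]

lemma pePow_mem {S : Set (ISemi n)} (hsub : IsSubsemigroup S) {φ : ISemi n} (hφ : φ ∈ S)
    {k : ℕ} (hk : 1 ≤ k) : pePow φ k ∈ S := by
  induction k, hk using Nat.le_induction with
  | base => rwa [pePow_one]
  | succ k _ ih => exact hsub _ ih _ hφ

variable {φ}

lemma pePow_fix {x : Fin n} (h : φ x = some x) (k : ℕ) : pePow φ k x = some x := by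
  induction k with
  | zero => rfl
  | succ k ih => exact (PEquiv.trans_eq_some ..).2 ⟨x, ih, h⟩

lemma trans_pePow {e : ISemi n} (h : e.trans φ = φ) {k : ℕ} (hk : 1 ≤ k) :
    e.trans (pePow φ k) = pePow φ k := by
  obtain ⟨j, rfl⟩ := Nat.exists_eq_add_of_le hk
  rw [pePow_add, pePow_one, ← PEquiv.trans_assoc, h]

end Power

section Subsemigroup

variable {n : ℕ} {S : Set (ISemi n)}

/-- If some element of `S` fixes `u`, there is a least idempotent of `S` fixing `u`. -/
lemma exists_least_idem (hsub : IsSubsemigroup S) {u : Fin n} (hu : ∃ φ ∈ S, φ u = some u) :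
    ∃ c ∈ S, c.trans c = c ∧ c u = some u ∧
      ∀ g ∈ S, g.trans g = g → g u = some u → ∀ x, c x = some x → g x = some x := by
  obtain ⟨φ, hφ, hφu⟩ := hu
  obtain ⟨k, hk, hidem⟩ := exists_pePow_idem φ
  obtain ⟨c, ⟨hcS, hc, hcu⟩, hmin⟩ := exists_minimal_of_wellFoundedLT
    (fun c : ISemi n => c ∈ S ∧ c.trans c = c ∧ c u = some u)
    ⟨_, pePow_mem hsub hφ hk, hidem, pePow_fix hφu k⟩
  refine ⟨c, hcS, hc, hcu, fun g hgS hg hgu x hx => ?_⟩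
  have hle : c ≤ c.trans g := by
    refine hmin ⟨hsub _ hcS _ hgS, trans_idem hc hg, (PEquiv.trans_eq_some ..).2 ⟨u, hcu, hgu⟩⟩ ?_
    intro x y hxy
    obtain ⟨z, hz, hzy⟩ := (PEquiv.trans_eq_some ..).1 hxy
    obtain rfl := apply_eq_of_idem hg hzy
    exact hz
  obtain ⟨z, hz, hzx⟩ := (PEquiv.trans_eq_some ..).1 (hle x x hx)
  obtain rfl := apply_eq_of_idem hc hz
  exact hzx

lemma exists_fix_of_idem_ne_bot {c : ISemi n} (hc : c.trans c = c) (hne : c ≠ ⊥) :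
    ∃ x, c x = some x := by
  by_contra! h
  refine hne ?_
  ext x y
  simp only [PEquiv.bot_apply, reduceCtorEq, iff_false]
  exact fun hxy => h x (fix_of_idem hc hxy)

/-- A semitransitive semigroup of singular maps contains the zero. -/
lemma bot_mem (hsub : IsSubsemigroup S) (hsing : ∀ φ ∈ S, IsSingular φ)
    (hst : Semitransitive S) (hne : S.Nonempty) : ⊥ ∈ S := by
  by_contra hbot
  obtain ⟨φ, hφ⟩ := hne
  obtain ⟨k, hk, hidem⟩ := exists_pePow_idem φ
  obtain ⟨c, ⟨hcS, hc⟩, hmin⟩ := exists_minimal_of_wellFoundedLT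
    (fun c : ISemi n => c ∈ S ∧ c.trans c = c) ⟨_, pePow_mem hsub hφ hk, hidem⟩
  obtain ⟨x, hx⟩ := exists_fix_of_idem_ne_bot hc fun h => hbot (h ▸ hcS)
  obtain ⟨y, hy⟩ := hsing c hcS
  have key : ∀ σ ∈ S, (∃ z, c z = some z ∧ σ x = some z) ∧ ∃ z, c z = some z ∧ σ z = some x := by
    intro σ hσ
    set ψ := c.trans (σ.trans c) with hψ
    obtain ⟨k, hk, hidem⟩ := exists_pePow_idem ψ
    have hcψ : c.trans ψ = ψ := by rw [hψ, ← PEquiv.trans_assoc, hc]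
    have hψS : ψ ∈ S := hsub _ hcS _ (hsub _ hσ _ hcS)
    have hle : c ≤ pePow ψ k := by
      refine hmin ⟨pePow_mem hsub hψS hk, hidem⟩ ?_
      intro a b hab
      rw [← trans_pePow hcψ hk] at hab
      obtain ⟨z, hz, hzb⟩ := (PEquiv.trans_eq_some ..).1 hab
      obtain rfl := apply_eq_of_idem hidem hzb
      exact hz
    have hfix : pePow ψ k x = some x := hle x x hx
    have hψσ : ∀ a b, ψ a = some b → c a = some a ∧ σ a = some b ∧ c b = some b := by
      intro a b hab
      obtain ⟨a', ha, hσb⟩ := (PEquiv.trans_eq_some ..).1 hab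
      obtain rfl := apply_eq_of_idem hc ha
      obtain ⟨b', hb, hbb⟩ := (PEquiv.trans_eq_some ..).1 hσb
      obtain rfl := apply_eq_of_idem hc hbb
      exact ⟨ha, hb, hbb⟩
    constructor
    · obtain ⟨j, rfl⟩ := Nat.exists_eq_add_of_le hk
      rw [pePow_add, pePow_one] at hfix
      obtain ⟨z, hz, -⟩ := (PEquiv.trans_eq_some ..).1 hfix
      exact ⟨z, (hψσ x z hz).2.2, (hψσ x z hz).2.1⟩
    · obtain ⟨j, rfl⟩ := Nat.exists_eq_add_of_le' hk
      rw [pePow_add, pePow_one] at hfix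
      obtain ⟨z, -, hz⟩ := (PEquiv.trans_eq_some ..).1 hfix
      exact ⟨z, (hψσ z x hz).1, (hψσ z x hz).2.1⟩
  obtain ⟨σ, hσ, h | h⟩ := hst x y
  · obtain ⟨⟨z, hz, hxz⟩, -⟩ := key σ hσ
    obtain rfl : y = z := Option.some_injective _ (h.symm.trans hxz)
    simp [hy] at hz
  · obtain ⟨-, z, hz, hzx⟩ := key σ hσ
    obtain rfl := σ.eq_of_apply_eq_some_s6 h hzx
    simp [hy] at hz

open Classical in
/-- The elements `c φ` with `φ` mapping the marked point of the idempotent `c` to a prescribed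
point below it are pairwise distinct and non-zero. -/
lemma sum_card_below_lt_ncard (hsub : IsSubsemigroup S) (hbot : ⊥ ∈ S) (C : Finset (ISemi n))
    (hCS : ∀ c ∈ C, c ∈ S) (hC : ∀ c ∈ C, c.trans c = c) (p : ISemi n → Fin n)
    (hp : ∀ c ∈ C, c (p c) = some (p c))
    (hanti : ∀ c ∈ C, ∀ d ∈ C, c (p d) = some (p d) → d (p c) = some (p c) → c = d) :
    ∑ c ∈ C, (Finset.univ.filter fun y => STGe S (p c) y).card < S.ncard := by
  have hex : ∀ c y, ∃ φ : ISemi n, STGe S (p c) y → φ ∈ S ∧ φ (p c) = some y := by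
    intro c y
    by_cases h : STGe S (p c) y
    · obtain ⟨φ, h1, h2⟩ := h
      exact ⟨φ, fun _ => ⟨h1, h2⟩⟩
    · exact ⟨⊥, fun h' => absurd h' h⟩
  choose φ hφ using hex
  set T := C.sigma fun c => Finset.univ.filter fun y => STGe S (p c) y with hT
  let f : (Σ _ : ISemi n, Fin n) → ISemi n := fun t => t.1.trans (φ t.1 t.2)
  have hf : ∀ t ∈ T, f t (p t.1) = some t.2 := by
    rintro ⟨c, y⟩ ht
    simp only [hT, Finset.mem_sigma, Finset.mem_filter, Finset.mem_univ, true_and] at ht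
    exact (PEquiv.trans_eq_some ..).2 ⟨_, hp c ht.1, (hφ c y ht.2).2⟩
  have hfix : ∀ s ∈ T, ∀ t ∈ T, f s = f t → s.1 (p t.1) = some (p t.1) := by
    intro s hs t ht hst
    have h := hf t ht
    rw [← hst] at h
    obtain ⟨z, hz, -⟩ := (PEquiv.trans_eq_some ..).1 h
    exact fix_of_idem (hC _ (Finset.mem_sigma.1 hs).1) hz
  have hinj : Set.InjOn f T := by
    intro s hs t ht hst
    have h1 : s.1 = t.1 := hanti _ (Finset.mem_sigma.1 hs).1 _ (Finset.mem_sigma.1 ht).1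
      (hfix s hs t ht hst) (hfix t ht s hs hst.symm)
    have h2 := hf s hs
    rw [hst, h1, hf t ht] at h2
    exact Sigma.ext h1 (heq_of_eq (Option.some_injective _ h2).symm)
  rw [← Finset.card_sigma, ← hT, ← Finset.card_image_of_injOn hinj, ← Set.ncard_coe_finset]
  refine Set.ncard_lt_ncard (Set.ssubset_iff_subset_ne.2 ⟨?_, ?_⟩) (Set.toFinite S)
  · intro α hα
    obtain ⟨⟨c, y⟩, ht, rfl⟩ := Finset.mem_image.1 (Finset.mem_coe.1 hα)
    simp only [hT, Finset.mem_sigma, Finset.mem_filter, Finset.mem_univ, true_and] at ht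
    exact hsub _ (hCS c ht.1) _ (hφ c y ht.2).1
  · intro heq
    rw [← heq] at hbot
    obtain ⟨t, ht, htb⟩ := Finset.mem_image.1 (Finset.mem_coe.1 hbot)
    have := hf t ht
    simp [htb] at this

lemma isSubsemigroup_symm_image (hsub : IsSubsemigroup S) :
    IsSubsemigroup (PEquiv.symm '' S) := by
  rintro _ ⟨a, ha, rfl⟩ _ ⟨b, hb, rfl⟩
  exact ⟨_, hsub _ hb _ ha, PEquiv.symm_trans_rev ..⟩

lemma stGe_symm_image {x y : Fin n} : STGe (PEquiv.symm '' S) x y ↔ STGe S y x := by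
  simp [STGe, PEquiv.eq_some_iff]

open Classical in
lemma sum_card_above_lt_ncard (hsub : IsSubsemigroup S) (hbot : ⊥ ∈ S) (C : Finset (ISemi n))
    (hCS : ∀ c ∈ C, c ∈ S) (hC : ∀ c ∈ C, c.trans c = c) (p : ISemi n → Fin n)
    (hp : ∀ c ∈ C, c (p c) = some (p c))
    (hanti : ∀ c ∈ C, ∀ d ∈ C, c (p d) = some (p d) → d (p c) = some (p c) → c = d) :
    ∑ c ∈ C, (Finset.univ.filter fun y => STGe S y (p c)).card < S.ncard := by
  have := sum_card_below_lt_ncard (isSubsemigroup_symm_image hsub) ⟨⊥, hbot, PEquiv.symm_bot⟩ C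
    (fun c hc => ⟨c, hCS c hc, symm_eq_of_idem (hC c hc)⟩) hC p hp hanti
  rw [Set.ncard_image_of_injective _ PEquiv.symm_injective] at this
  simpa only [stGe_symm_image] using this

end Subsemigroup

lemma Finset.Nonempty.exists_forall_rel {α : Type*} {r : α → α → Prop}
    (htot : ∀ x y, r x y ∨ r y x) (htrans : ∀ x y z, r x y → r y z → r x z)
    {s : Finset α} (hs : s.Nonempty) : ∃ x ∈ s, ∀ y ∈ s, r x y := by
  induction hs using Finset.Nonempty.cons_induction with
  | singleton a => exact ⟨a, by simp, by simpa using htot a a⟩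
  | cons a s ha hs ih =>
    obtain ⟨x, hx, h⟩ := ih
    rcases htot x a with hxa | hax
    · refine ⟨x, by simp [hx], fun y hy => ?_⟩
      rcases Finset.mem_cons.1 hy with rfl | hy
      exacts [hxa, h y hy]
    · refine ⟨a, by simp, fun y hy => ?_⟩
      rcases Finset.mem_cons.1 hy with rfl | hy
      exacts [(htot _ _).elim id id, htrans _ _ _ hax (h y hy)]

open Classical in
/-- With `c u` the least idempotent of `S` fixing `u` and `q` the number of these idempotents,
`(q + 1) n + 2 ≤ 2 |S|`. -/
lemma card_least_idem_bound {n : ℕ} (hn : 1 ≤ n) {S : Set (ISemi n)} (hsub : IsSubsemigroup S)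
    (hst : Semitransitive S) (hbot : ⊥ ∈ S) (c : Fin n → ISemi n) (hcS : ∀ u, c u ∈ S)
    (hc : ∀ u, (c u).trans (c u) = c u) (hcu : ∀ u, c u u = some u)
    (hleast : ∀ u, ∀ g ∈ S, g.trans g = g → g u = some u → ∀ x, c u x = some x → g x = some x) :
    ((Finset.univ.image c).card + 1) * n + 2 ≤ 2 * S.ncard := by
  have htot : ∀ x y, STGe S x y ∨ STGe S y x := by
    intro x y
    obtain ⟨φ, hφ, h | h⟩ := hst x y
    exacts [.inl ⟨φ, hφ, h⟩, .inr ⟨φ, hφ, h⟩]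
  have htrans : ∀ x y z, STGe S x y → STGe S y z → STGe S x z := by
    rintro x y z ⟨φ, hφ, hxy⟩ ⟨ψ, hψ, hyz⟩
    exact ⟨_, hsub _ hφ _ hψ, (PEquiv.trans_eq_some ..).2 ⟨y, hxy, hyz⟩⟩
  set C := Finset.univ.image c with hCdef
  let K : ISemi n → Finset (Fin n) := fun d => Finset.univ.filter fun u => c u = d
  have hK : ∀ d ∈ C, (K d).Nonempty := by
    intro d hd
    obtain ⟨u, -, rfl⟩ := Finset.mem_image.1 hd
    exact ⟨u, by simp [K]⟩
  have htop : ∀ d, ∃ x, d ∈ C → x ∈ K d ∧ ∀ y ∈ K d, STGe S x y := by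
    intro d
    by_cases hd : d ∈ C
    · obtain ⟨x, hx⟩ := (hK d hd).exists_forall_rel htot htrans
      exact ⟨x, fun _ => hx⟩
    · exact ⟨⟨0, hn⟩, fun h => absurd h hd⟩
  have hbottom : ∀ d, ∃ x, d ∈ C → x ∈ K d ∧ ∀ y ∈ K d, STGe S y x := by
    intro d
    by_cases hd : d ∈ C
    · obtain ⟨x, hx⟩ := (hK d hd).exists_forall_rel (r := fun x y => STGe S y x)
        (fun x y => htot y x) (fun x y z h1 h2 => htrans _ _ _ h2 h1)
      exact ⟨x, fun _ => hx⟩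
    · exact ⟨⟨0, hn⟩, fun h => absurd h hd⟩
  choose p hp using htop
  choose q hq using hbottom
  have hCS : ∀ d ∈ C, d ∈ S := by
    intro d hd
    obtain ⟨u, -, rfl⟩ := Finset.mem_image.1 hd
    exact hcS u
  have hC : ∀ d ∈ C, d.trans d = d := by
    intro d hd
    obtain ⟨u, -, rfl⟩ := Finset.mem_image.1 hd
    exact hc u
  have hfix : ∀ r : ISemi n → Fin n, (∀ d ∈ C, r d ∈ K d) → ∀ d ∈ C, d (r d) = some (r d) := by
    intro r hr d hd
    have h := hcu (r d)
    rwa [(Finset.mem_filter.1 (hr d hd)).2] at h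
  have hanti : ∀ r : ISemi n → Fin n, (∀ d ∈ C, r d ∈ K d) → ∀ d ∈ C, ∀ d' ∈ C,
      d (r d') = some (r d') → d' (r d) = some (r d) → d = d' := by
    intro r hr d hd d' hd' h1 h2
    have e1 := (Finset.mem_filter.1 (hr d hd)).2
    have e2 := (Finset.mem_filter.1 (hr d' hd')).2
    refine idem_ext (hC d hd) (hC d' hd') fun x => ⟨?_, ?_⟩
    · have := hleast (r d) d' (hCS _ hd') (hC _ hd') h2 x
      rwa [e1] at this
    · have := hleast (r d') d (hCS _ hd) (hC _ hd) h1 x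
      rwa [e2] at this
  have hpK : ∀ d ∈ C, p d ∈ K d := fun d hd => (hp d hd).1
  have hqK : ∀ d ∈ C, q d ∈ K d := fun d hd => (hq d hd).1
  have h1 := sum_card_below_lt_ncard hsub hbot C hCS hC p (hfix p hpK) (hanti p hpK)
  have h2 := sum_card_above_lt_ncard hsub hbot C hCS hC q (hfix q hqK) (hanti q hqK)
  have h3 : ∀ d ∈ C, n + (K d).card ≤ (Finset.univ.filter fun y => STGe S (p d) y).card +
      (Finset.univ.filter fun y => STGe S y (q d)).card := by
    intro d hd
    rw [← Finset.card_union_add_card_inter]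
    refine add_le_add ?_ (Finset.card_le_card fun u hu => ?_)
    · rw [Finset.eq_univ_of_forall (s := _ ∪ _), Finset.card_univ, Fintype.card_fin]
      intro y
      simp only [Finset.mem_union, Finset.mem_filter, Finset.mem_univ, true_and]
      exact (htot (p d) y).imp_right fun h => htrans _ _ _ h ((hq d hd).2 _ (hpK d hd))
    · simp only [Finset.mem_inter, Finset.mem_filter, Finset.mem_univ, true_and]
      exact ⟨(hp d hd).2 u hu, (hq d hd).2 u hu⟩
  have h4 := Finset.sum_le_sum h3
  rw [Finset.sum_add_distrib, Finset.sum_add_distrib, Finset.sum_const, smul_eq_mul,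
    ← Finset.card_eq_sum_card_image, Finset.card_univ, Fintype.card_fin] at h4
  linarith

/-- for a non-zero idempotent `e` of a semitransitive subsemigroup `S`
of the singular part with `|S| ≤ 2n`, every element of `eSe` is nilpotent or has
some positive power equal to `e` (i.e. is a group element over `e`). -/
theorem stmt6 (n : ℕ) (hn : 1 ≤ n) (S : Set (ISemi n))
    (hsub : IsSubsemigroup S)
    (hsing : ∀ φ ∈ S, IsSingular φ)
    (hst : Semitransitive S)
    (hcard : S.ncard ≤ 2 * n)
    (e : ISemi n) (he : e ∈ S) (hid : e.trans e = e) (hne : e ≠ ⊥)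
    (φ : ISemi n) (hφ : ∃ σ ∈ S, φ = e.trans (σ.trans e)) :
    (∃ k : ℕ, 1 ≤ k ∧ pePow φ k = ⊥) ∨ (∃ k : ℕ, 1 ≤ k ∧ pePow φ k = e) := by
  classical
  obtain ⟨σ, hσ, rfl⟩ := hφ
  set φ := e.trans (σ.trans e) with hφ
  obtain ⟨k, hk, hg⟩ := exists_pePow_idem φ
  set g := pePow φ k with hgdef
  by_contra! hcon
  have hgS : g ∈ S := pePow_mem hsub (hsub _ he _ (hsub _ hσ _ he)) hk
  have heg : e.trans g = g := trans_pePow (by rw [hφ, ← PEquiv.trans_assoc, hid]) hk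
  have hge : ∀ x, g x = some x → e x = some x := by
    intro x hx
    rw [← heg] at hx
    obtain ⟨z, hz, -⟩ := (PEquiv.trans_eq_some ..).1 hx
    exact fix_of_idem hid hz
  obtain ⟨u, hu⟩ := exists_fix_of_idem_ne_bot hg (hcon.1 k hk)
  obtain ⟨v, hve, hvg⟩ : ∃ v, e v = some v ∧ g v ≠ some v := by
    by_contra! h
    exact hcon.2 k hk (idem_ext hg hid fun x => ⟨hge x, h x⟩)
  obtain ⟨w, hw⟩ := hsing e he
  have hex : ∀ u, ∃ c ∈ S, c.trans c = c ∧ c u = some u ∧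
      ∀ g ∈ S, g.trans g = g → g u = some u → ∀ x, c x = some x → g x = some x := fun u => by
    obtain ⟨φ, hφ, h⟩ := hst u u
    exact exists_least_idem hsub ⟨φ, hφ, h.elim id id⟩
  choose c hcS hc hcu hleast using hex
  have hbound := card_least_idem_bound hn hsub hst (bot_mem hsub hsing hst ⟨e, he⟩)
    c hcS hc hcu hleast
  have huv : c u ≠ c v := fun h => hvg (hleast u g hgS hg hu v (h ▸ hcu v))
  have hnw : ∀ x, e x = some x → c x ≠ c w := fun x hx h => by
    simpa [hw] using hleast x e he hid hx w (h ▸ hcu w)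
  have hthree : 3 ≤ (Finset.univ.image c).card := by
    rw [← Finset.card_eq_three.2 ⟨_, _, _, huv, hnw u (hge u hu), hnw v hve, rfl⟩]
    refine Finset.card_le_card fun d hd => ?_
    simp only [Finset.mem_insert, Finset.mem_singleton] at hd
    rcases hd with rfl | rfl | rfl <;> simp
  nlinarith
end
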